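/- Let x, y, q be complex numbers with |q| < 1, and suppose y·q^(2k+1) ≠ 1 for every integer k ≥ 0. Then Σ_{i,j≥0} (−1)^j · (x;q²)_j · y^(i+j) · q^(i²+j²+2ij) / ((q²;q²)_i · (q²;q²)_j) = (yq;q²)_∞ · Σ_{n≥0} (−x;q²)_n · y^n · q^(n²) / ((yq;q²)_n · (q²;q²)_n). -/

import Mathlib

/-- Finite q-Pochhammer symbol `(a; q)_n = ∏_{k=0}^{n-1} (1 - a q^k)`. -/
noncomputable def qPoch (a q : ℂ) (n : ℕ) : ℂ := ∏ k ∈ Finset.range n, (1 - a * q ^ k)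

/-- Infinite q-Pochhammer symbol `(a; q)_∞ = ∏_{k=0}^{∞} (1 - a q^k)`. -/
noncomputable def qPochInf (a q : ℂ) : ℂ := ∏' k : ℕ, (1 - a * q ^ k)

open Filter Topology PowerSeries

lemma qPoch_zero (a q : ℂ) : qPoch a q 0 = 1 := by simp [qPoch]

lemma qPoch_succ (a q : ℂ) (n : ℕ) : qPoch a q (n + 1) = qPoch a q n * (1 - a * q ^ n) :=
  Finset.prod_range_succ _ _

lemma qPoch_zero_left (q : ℂ) (n : ℕ) : qPoch 0 q n = 1 := by simp [qPoch]

lemma one_sub_pow_succ_ne_zero {q : ℂ} (hq : ‖q‖ < 1) (n : ℕ) : 1 - q ^ (n + 1) ≠ 0 := by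
  intro h
  have h1 : ‖q ^ (n + 1)‖ < 1 := by
    rw [norm_pow]; exact pow_lt_one₀ (norm_nonneg _) hq (by simp)
  rw [← sub_eq_zero.mp h] at h1
  simp at h1

lemma qPoch_self_ne_zero {q : ℂ} (hq : ‖q‖ < 1) (n : ℕ) : qPoch q q n ≠ 0 := by
  refine Finset.prod_ne_zero_iff.mpr fun k _ => ?_
  rw [← pow_succ']
  exact one_sub_pow_succ_ne_zero hq k

lemma constantCoeff_rescale (a : ℂ) (f : ℂ⟦X⟧) :
    constantCoeff (rescale a f) = constantCoeff f := by
  rw [← coeff_zero_eq_constantCoeff_apply, coeff_rescale]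
  simp

/-- The generating series `∑ zⁿ / (q; q)_n`. -/
noncomputable def qExpSeries (q : ℂ) : ℂ⟦X⟧ := PowerSeries.mk fun n => 1 / qPoch q q n

/-- The generating series `∑ (-1)ⁿ (x; q)_n zⁿ / (q; q)_n`. -/
noncomputable def qBinomSeries (x q : ℂ) : ℂ⟦X⟧ :=
  PowerSeries.mk fun n => (-1) ^ n * qPoch x q n / qPoch q q n

lemma rescale_qExpSeries {q : ℂ} (hq : ‖q‖ < 1) :
    rescale q (qExpSeries q) = (1 - X) * qExpSeries q := by
  ext n
  cases n with
  | zero => simp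
  | succ n =>
    have h1 := qPoch_self_ne_zero hq n
    have h2 := one_sub_pow_succ_ne_zero hq n
    rw [sub_mul, one_mul, map_sub, coeff_succ_X_mul]
    simp only [qExpSeries, coeff_rescale, coeff_mk, qPoch_succ, ← pow_succ']
    field_simp
    ring

lemma one_add_X_mul_qBinomSeries {q : ℂ} (hq : ‖q‖ < 1) (x : ℂ) :
    (1 + X) * qBinomSeries x q = (1 + C x * X) * rescale q (qBinomSeries x q) := by
  ext n
  cases n with
  | zero => simp [constantCoeff_rescale]
  | succ n =>
    have h1 := qPoch_self_ne_zero hq n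
    have h2 := one_sub_pow_succ_ne_zero hq n
    rw [add_mul, add_mul, one_mul, one_mul, map_add, map_add, mul_assoc, coeff_C_mul,
      coeff_succ_X_mul, coeff_succ_X_mul]
    simp only [qBinomSeries, coeff_rescale, coeff_mk, qPoch_succ, ← pow_succ']
    field_simp
    ring

lemma eq_zero_of_one_sub_X_sq_mul_eq {q : ℂ} (hq : ‖q‖ < 1) (x : ℂ) {H : ℂ⟦X⟧}
    (hH : (1 - X ^ 2) * H = (1 + C x * X) * rescale q H) (h0 : coeff 0 H = 0) : H = 0 := by
  ext n
  induction n using Nat.strong_induction_on with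
  | _ n ih =>
    rcases n with _ | n
    · simpa using h0
    · have h := congrArg (coeff (n + 1)) hH
      have h2 : coeff (n + 1) (X ^ 2 * H) = 0 := by
        rw [pow_two, mul_assoc, coeff_succ_X_mul]
        rcases n with _ | n
        · simp
        · rw [coeff_succ_X_mul, ih n (by omega), map_zero]
      rw [sub_mul, add_mul, one_mul, one_mul, map_sub, map_add, mul_assoc, coeff_C_mul,
        coeff_succ_X_mul, h2, coeff_rescale, coeff_rescale, ih n (by omega)] at h
      have h3 : (1 - q ^ (n + 1)) * coeff (n + 1) H = 0 := by
        simp only [map_zero] at h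
        linear_combination h
      simpa [one_sub_pow_succ_ne_zero hq n] using h3

lemma one_sub_X_sq_mul_qExpSeries_mul_qBinomSeries {q : ℂ} (hq : ‖q‖ < 1) (x : ℂ) :
    (1 - X ^ 2) * (qExpSeries q * qBinomSeries x q) =
      (1 + C x * X) * rescale q (qExpSeries q * qBinomSeries x q) := by
  rw [map_mul, rescale_qExpSeries hq]
  linear_combination (1 - X) * qExpSeries q * one_add_X_mul_qBinomSeries hq x

lemma rescale_neg_one_functional_eq {q x : ℂ} {G : ℂ⟦X⟧}
    (hG : (1 - X ^ 2) * G = (1 + C x * X) * rescale q G) :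
    (1 - X ^ 2) * rescale (-1) G = (1 + C (-x) * X) * rescale q (rescale (-1) G) := by
  have h := congrArg (rescale (-1 : ℂ)) hG
  rw [map_mul, map_mul, rescale_rescale, mul_comm q, ← rescale_rescale] at h
  have hC : rescale (-1 : ℂ) (C x) = C x := by
    ext n; rcases n with _ | n <;> simp [coeff_rescale, coeff_C]
  simpa [rescale_X, hC] using h

lemma qExpSeries_mul_qBinomSeries_neg {q : ℂ} (hq : ‖q‖ < 1) (x : ℂ) :
    qExpSeries q * qBinomSeries (-x) q = rescale (-1) (qExpSeries q * qBinomSeries x q) := by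
  set G := qExpSeries q * qBinomSeries x q with hG
  have h1 := one_sub_X_sq_mul_qExpSeries_mul_qBinomSeries hq (-x)
  have h2 : (1 - X ^ 2) * rescale (-1) G = (1 + C (-x) * X) * rescale q (rescale (-1) G) :=
    rescale_neg_one_functional_eq (one_sub_X_sq_mul_qExpSeries_mul_qBinomSeries hq x)
  rw [← sub_eq_zero]
  refine eq_zero_of_one_sub_X_sq_mul_eq hq (-x) ?_ ?_
  · rw [map_sub]
    linear_combination h1 - h2
  · rw [map_sub, coeff_rescale, hG]
    simp [qExpSeries, qBinomSeries, qPoch_zero]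

/-- The summand `(x; q²)_n yⁿ q^(n²) / (q²; q²)_n`. -/
noncomputable def qTerm (x y q : ℂ) (n : ℕ) : ℂ :=
  qPoch x (q ^ 2) n * y ^ n * q ^ (n ^ 2) / qPoch (q ^ 2) (q ^ 2) n

lemma norm_sq_lt_one {q : ℂ} (hq : ‖q‖ < 1) : ‖q ^ 2‖ < 1 := by
  rw [norm_pow]; exact pow_lt_one₀ (norm_nonneg _) hq (by simp)

lemma qTerm_succ {q : ℂ} (hq : ‖q‖ < 1) (x y : ℂ) (n : ℕ) :
    qTerm x y q (n + 1) =
      (1 - x * (q ^ 2) ^ n) * y * (q * (q ^ 2) ^ n) / (1 - (q ^ 2) ^ (n + 1)) * qTerm x y q n := by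
  have h1 := qPoch_self_ne_zero (norm_sq_lt_one hq) n
  have h2 := one_sub_pow_succ_ne_zero (norm_sq_lt_one hq) n
  simp only [qTerm, qPoch_succ, ← pow_succ']
  field_simp
  ring

lemma summable_norm_qTerm {q : ℂ} (hq : ‖q‖ < 1) (x y : ℂ) :
    Summable fun n => ‖qTerm x y q n‖ := by
  have hp : Tendsto (fun n : ℕ => (q ^ 2) ^ n) atTop (𝓝 0) :=
    tendsto_pow_atTop_nhds_zero_of_norm_lt_one (norm_sq_lt_one hq)
  have hr : Tendsto (fun n : ℕ => (1 - x * (q ^ 2) ^ n) * y * (q * (q ^ 2) ^ n) /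
      (1 - (q ^ 2) ^ (n + 1))) atTop (𝓝 0) := by
    have := (((hp.const_mul x).const_sub 1).mul_const y).mul (hp.const_mul q) |>.div
      ((hp.comp (tendsto_add_atTop_nat 1)).const_sub 1) (by simp)
    simpa [Pi.div_def] using this
  refine summable_of_ratio_norm_eventually_le (r := 1 / 2) (by norm_num) ?_
  filter_upwards [hr.norm.eventually_le_const (show ‖(0 : ℂ)‖ < 1 / 2 by norm_num)] with n hn
  rw [norm_norm, norm_norm, qTerm_succ hq, norm_mul]
  gcongr

lemma qTerm_mul_sq (x y q : ℂ) (k n : ℕ) :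
    qTerm x (y * (q ^ 2) ^ k) q n = qTerm x y q n * q ^ (2 * k * n) := by
  simp only [qTerm, mul_pow, ← pow_mul]
  ring

lemma tsum_qTerm_zero {q : ℂ} (hq : ‖q‖ < 1) (y : ℂ) :
    ∑' n, qTerm 0 (-y) q n = (1 - y * q) * ∑' n, qTerm 0 (-(y * q ^ 2)) q n := by
  have hs (z : ℂ) : Summable (qTerm 0 z q) := (summable_norm_qTerm hq 0 z).of_norm
  have h0 (z : ℂ) : qTerm 0 z q 0 = 1 := by simp [qTerm, qPoch_zero]
  have key (n : ℕ) : qTerm 0 (-y) q (n + 1) =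
      qTerm 0 (-(y * q ^ 2)) q (n + 1) - y * q * qTerm 0 (-(y * q ^ 2)) q n := by
    have h1 := qPoch_self_ne_zero (norm_sq_lt_one hq) n
    have h2 := one_sub_pow_succ_ne_zero (norm_sq_lt_one hq) n
    have h3 (n : ℕ) : qTerm 0 (-(y * q ^ 2)) q n = qTerm 0 (-y) q n * (q ^ 2) ^ n := by
      have := qTerm_mul_sq 0 (-y) q 1 n
      rwa [pow_one, neg_mul, mul_one, pow_mul] at this
    rw [h3, h3, qTerm_succ hq]
    field_simp
    ring
  rw [(hs (-y)).tsum_eq_zero_add, h0]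
  simp_rw [key]
  rw [((summable_nat_add_iff 1).2 (hs _)).tsum_sub ((hs _).mul_left _), tsum_mul_left, sub_mul,
    one_mul, (hs (-(y * q ^ 2))).tsum_eq_zero_add, h0]
  ring

lemma multipliable_one_sub_mul_pow {q : ℂ} (hq : ‖q‖ < 1) (a : ℂ) :
    Multipliable fun k : ℕ => 1 - a * q ^ k := by
  simpa [sub_eq_add_neg] using Complex.multipliable_one_add_of_summable
    ((summable_geometric_of_norm_lt_one hq).mul_left a).neg

lemma qPochInf_eq_qPoch_mul {q : ℂ} (hq : ‖q‖ < 1) (a : ℂ) (n : ℕ) :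
    qPochInf a q = qPoch a q n * qPochInf (a * q ^ n) q := by
  have h : (fun k : ℕ => 1 - a * q ^ (k + n)) = fun k => 1 - a * q ^ n * q ^ k := by
    ext k; ring
  have h' := Multipliable.prod_mul_tprod_nat_mul' (f := fun k : ℕ => 1 - a * q ^ k) (k := n)
    (by rw [h]; exact multipliable_one_sub_mul_pow hq _)
  rw [h] at h'
  exact h'.symm

/-- Euler's expansion of the infinite `q`-Pochhammer symbol. -/
lemma qPochInf_eq_tsum {q : ℂ} (hq : ‖q‖ < 1) (y : ℂ) :
    qPochInf (y * q) (q ^ 2) = ∑' n, qTerm 0 (-y) q n := by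
  have hQ := norm_sq_lt_one hq
  have hfin (k : ℕ) : ∑' n, qTerm 0 (-y) q n =
      qPoch (y * q) (q ^ 2) k * ∑' n, qTerm 0 (-(y * (q ^ 2) ^ k)) q n := by
    induction k with
    | zero => simp [qPoch_zero]
    | succ k ih =>
      rw [ih, tsum_qTerm_zero hq, qPoch_succ, pow_succ]
      ring_nf
  have hlim : Tendsto (fun k => ∑' n, qTerm 0 (-(y * (q ^ 2) ^ k)) q n) atTop (𝓝 1) := by
    have h1 : ∑' n, (if n = 0 then (1 : ℂ) else 0) = 1 := by simp
    rw [← h1]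
    refine tendsto_tsum_of_dominated_convergence (summable_norm_qTerm hq 0 (-y)) ?_ ?_
    · intro n
      simp_rw [← neg_mul, qTerm_mul_sq]
      rcases n with _ | n
      · simp [qTerm, qPoch_zero]
      · have h2 : Tendsto (fun k : ℕ => (q ^ (2 * (n + 1))) ^ k) atTop (𝓝 0) := by
          refine tendsto_pow_atTop_nhds_zero_of_norm_lt_one ?_
          rw [norm_pow]
          exact pow_lt_one₀ (norm_nonneg _) hq (by simp)
        have h3 := h2.const_mul (qTerm 0 (-y) q (n + 1))
        rw [mul_zero] at h3
        refine h3.congr fun k => ?_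
        rw [← pow_mul]; ring_nf
    · refine Eventually.of_forall fun k n => ?_
      rw [← neg_mul, qTerm_mul_sq, norm_mul, norm_pow]
      exact mul_le_of_le_one_right (norm_nonneg _) (pow_le_one₀ (norm_nonneg _) hq.le)
  have hprod : Tendsto (fun k => qPoch (y * q) (q ^ 2) k) atTop (𝓝 (qPochInf (y * q) (q ^ 2))) :=
    (multipliable_one_sub_mul_pow hQ (y * q)).hasProd.tendsto_prod_nat
  have h := hprod.mul hlim
  simp_rw [← hfin, mul_one] at h
  exact tendsto_nhds_unique h tendsto_const_nhds

lemma summable_qTerm_mul_qTerm {q : ℂ} (hq : ‖q‖ < 1) (x x' y y' : ℂ) :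
    Summable fun p : ℕ × ℕ => qTerm x y q p.1 * qTerm x' y' q p.2 * q ^ (2 * p.1 * p.2) := by
  refine Summable.of_norm_bounded
    ((summable_norm_qTerm hq x y).mul_of_nonneg (summable_norm_qTerm hq x' y')
      (fun _ => norm_nonneg _) fun _ => norm_nonneg _) fun p => ?_
  rw [norm_mul, norm_mul, norm_pow]
  exact mul_le_of_le_one_right (by positivity) (pow_le_one₀ (norm_nonneg _) hq.le)

lemma tsum_qTerm_mul_qTerm {q : ℂ} (hq : ‖q‖ < 1) (x y : ℂ) :
    ∑' p : ℕ × ℕ, qTerm 0 y q p.1 * qTerm x (-y) q p.2 * q ^ (2 * p.1 * p.2) =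
      ∑' n, y ^ n * q ^ (n ^ 2) * coeff n (qExpSeries (q ^ 2) * qBinomSeries x (q ^ 2)) := by
  have hs := summable_qTerm_mul_qTerm hq 0 x y (-y)
  have hs' := Finset.HasAntidiagonal.sigmaAntidiagonalEquivProd.summable_iff.mpr hs
  simp only [Function.comp_def] at hs'
  rw [← Finset.HasAntidiagonal.sigmaAntidiagonalEquivProd.tsum_eq,
    hs'.tsum_sigma' fun n => (hasSum_fintype _).summable]
  refine tsum_congr fun n => ?_
  rw [tsum_fintype, coeff_mul, Finset.mul_sum,
    ← Finset.sum_coe_sort (Finset.HasAntidiagonal.antidiagonal n)]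
  refine Finset.sum_congr rfl fun ⟨p, hp⟩ _ => ?_
  obtain rfl := Finset.HasAntidiagonal.mem_antidiagonal.mp hp
  simp only [Finset.HasAntidiagonal.sigmaAntidiagonalEquivProd_apply, qTerm, qExpSeries,
    qBinomSeries, coeff_mk, qPoch_zero_left, neg_pow y]
  ring

lemma tsum_qTerm_mul_qTerm_neg {q : ℂ} (hq : ‖q‖ < 1) (x y : ℂ) :
    ∑' p : ℕ × ℕ, qTerm 0 (-y) q p.1 * qTerm (-x) y q p.2 * q ^ (2 * p.1 * p.2) =
      ∑' p : ℕ × ℕ, qTerm 0 y q p.1 * qTerm x (-y) q p.2 * q ^ (2 * p.1 * p.2) := by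
  have h := tsum_qTerm_mul_qTerm hq (-x) (-y)
  rw [neg_neg] at h
  rw [h, tsum_qTerm_mul_qTerm hq]
  refine tsum_congr fun n => ?_
  have h1 : (-1 : ℂ) ^ n * (-1) ^ n = 1 := by rw [← mul_pow]; simp
  rw [qExpSeries_mul_qBinomSeries_neg (norm_sq_lt_one hq), coeff_rescale, neg_pow y]
  linear_combination
    y ^ n * q ^ n ^ 2 * coeff n (qExpSeries (q ^ 2) * qBinomSeries x (q ^ 2)) * h1

theorem stmt_0 (x y q : ℂ) (hq : ‖q‖ < 1)
    (hy : ∀ k : ℕ, y * q ^ (2 * k + 1) ≠ 1) :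
    (∑' p : ℕ × ℕ,
        (-1 : ℂ) ^ p.2 * qPoch x (q ^ 2) p.2 * y ^ (p.1 + p.2) *
          q ^ (p.1 ^ 2 + p.2 ^ 2 + 2 * p.1 * p.2) /
          (qPoch (q ^ 2) (q ^ 2) p.1 * qPoch (q ^ 2) (q ^ 2) p.2))
      = qPochInf (y * q) (q ^ 2) *
        ∑' n : ℕ,
          qPoch (-x) (q ^ 2) n * y ^ n * q ^ (n ^ 2) /
            (qPoch (y * q) (q ^ 2) n * qPoch (q ^ 2) (q ^ 2) n) := by
  have hQ := norm_sq_lt_one hq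
  have hs := summable_qTerm_mul_qTerm hq (-x) 0 y (-y)
  have hterm (n : ℕ) : qPochInf (y * q) (q ^ 2) * (qPoch (-x) (q ^ 2) n * y ^ n * q ^ (n ^ 2) /
      (qPoch (y * q) (q ^ 2) n * qPoch (q ^ 2) (q ^ 2) n)) =
      ∑' m, qTerm (-x) y q n * qTerm 0 (-y) q m * q ^ (2 * n * m) := by
    have hne : qPoch (y * q) (q ^ 2) n ≠ 0 := by
      refine Finset.prod_ne_zero_iff.mpr fun k _ h => hy k ?_
      rw [pow_succ', pow_mul]
      linear_combination -h
    have h1 := qPoch_self_ne_zero hQ n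
    have h2 : y * q * (q ^ 2) ^ n = y * (q ^ 2) ^ n * q := by ring
    rw [qPochInf_eq_qPoch_mul hQ (y * q) n, h2, qPochInf_eq_tsum hq]
    simp_rw [← neg_mul, qTerm_mul_sq, mul_assoc, tsum_mul_left]
    rw [qTerm]
    field_simp
  rw [← tsum_mul_left]
  simp_rw [hterm]
  rw [← hs.tsum_prod' fun n => hs.prod_factor n]
  calc _ = ∑' p : ℕ × ℕ, qTerm 0 y q p.1 * qTerm x (-y) q p.2 * q ^ (2 * p.1 * p.2) := by
        refine tsum_congr fun p => ?_
        simp only [qTerm, qPoch_zero_left, neg_pow y]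
        ring
    _ = _ := by
        rw [← tsum_qTerm_mul_qTerm_neg hq, ← (Equiv.prodComm ℕ ℕ).tsum_eq]
        refine tsum_congr fun p => ?_
        simp only [Equiv.prodComm_apply, Prod.fst_swap, Prod.snd_swap]
        ring
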